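/- arXiv:2411.19365 — 2 statements merged into one kernel-verified Lean document; each statement's English description precedes it below -/
import Mathlib

section
/- In every execution of the Figure 3 algorithm, suppose a Take operation tk performs a successful t&s() of TS[a], and let x be the element tk last read from Items[a]. Then TS[a] = 0 and Items[a] = x hold continuously between the producer's last write to Items[a] prior to that read and the moment tk performs its successful t&s(). -/
/-!
A formal model of the algorithm of Figure 3 (a wait-free, linearizable
1-bounded bag with one producer and `n` consumers).

Locations `1 .. n+1` are modelled as `Fin (n+1)` with index `0` playing the
role of location `1` (so `TS[1] = 1` initially becomes `ts 0 = true`).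
Registers holding elements or `⊥` are modelled as `Option ℕ` (with `none` = ⊥),
test&set objects as `Bool` (`true` = 1).

An execution is a list of actions (`Act`), each of which performs exactly one
shared-memory access (an invocation of an operation is merged with the first
shared access of that operation, and nondeterministic choices and results of
accesses are recorded in the action).  `step` is the (partial, deterministic)
transition function; a list `tr` is a (finite) execution iff
`run n tr (init n) = some C` for some configuration `C`.
-/

namespace Fig3

abbrev Loc (n : ℕ) := Fin (n + 1)

/-- Local state (program counter and local variables) of the single producer,
apart from the persistent local variables `used` and `m` that are kept in the
configuration. -/
inductive PSt (n : ℕ) where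
  | idle : PSt n
  | clear (x : ℕ) : PSt n
  | collect (x : ℕ) (i : ℕ) (hz : Finset (Loc n)) : PSt n
  | allocSt (x : ℕ) (hz : Finset (Loc n)) : PSt n
  | resets (x : ℕ) (hz : Finset (Loc n)) (todo : Finset (Loc n)) : PSt n
  deriving DecidableEq

/-- Local state of a consumer. -/
inductive CSt (n : ℕ) where
  | idle : CSt n
  | haz (a : Loc n) : CSt n
  | read (a : Loc n) : CSt n
  | tas (a : Loc n) (x : ℕ) : CSt n
  | clear (res : Option ℕ) : CSt n
  deriving DecidableEq

structure Cfg (n : ℕ) where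
  items : Loc n → Option ℕ
  ts : Loc n → Bool
  alloc : Loc n
  haz : Fin n → Option (Loc n)
  pst : PSt n
  used : Finset (Loc n)
  m : Loc n
  cst : Fin n → CSt n

inductive Act (n : ℕ) where
  /-- the producer begins `Insert(x)` by reading `TS[m]`, obtaining `v`;
      if `v = false` (i.e. 0) the operation immediately returns FULL -/
  | insCheck (x : ℕ) (v : Bool) : Act n
  /-- the producer writes ⊥ to `Items[m]` and adds `m` to `used` -/
  | insClear : Act n
  /-- the producer reads the next entry of `Hazards` -/
  | insCollect : Act n
  /-- the producer chooses a fresh non-hazardous location `m'`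
      and writes it to `Allocated` -/
  | insAlloc (m' : Loc n) : Act n
  /-- the producer resets `TS[k]` -/
  | insReset (k : Loc n) : Act n
  /-- the producer writes its element to `Items[m]` and returns OK -/
  | insWrite : Act n
  /-- consumer `i` begins `Take()` by reading `Allocated`, obtaining `a` -/
  | takeBegin (i : Fin n) (a : Loc n) : Act n
  /-- consumer `i` writes its announced location to `Hazards[i]` -/
  | takeHaz (i : Fin n) : Act n
  /-- consumer `i` reads `Items[a]`, obtaining `x` -/
  | takeRead (i : Fin n) (x : Option ℕ) : Act n
  /-- consumer `i` performs `t&s()` on `TS[a]`; `won = true` iff it was successful -/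
  | takeTas (i : Fin n) (won : Bool) : Act n
  /-- consumer `i` writes ⊥ to `Hazards[i]` and returns `res`
      (`none` meaning EMPTY) -/
  | takeEnd (i : Fin n) (res : Option ℕ) : Act n
  deriving DecidableEq

/-- One step of the algorithm: `step n C e = some C'` iff action `e` is enabled
in configuration `C` (including that all recorded read/`t&s` results match the
shared state) and leads to configuration `C'`. -/
def step (n : ℕ) (C : Cfg n) : Act n → Option (Cfg n)
  | .insCheck x v =>
      match C.pst with
      | .idle =>
          if v = C.ts C.m then
            some (if v then { C with pst := .clear x } else C)
          else none
      | _ => none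
  | .insClear =>
      match C.pst with
      | .clear x =>
          some { C with
                   items := Function.update C.items C.m none
                   used := insert C.m C.used
                   pst := if n = 0 then .allocSt x ∅ else .collect x 0 ∅ }
      | _ => none
  | .insCollect =>
      match C.pst with
      | .collect x i hz =>
          if h : i < n then
            let hz' := match C.haz ⟨i, h⟩ with
                       | some a => insert a hz
                       | none => hz
            some { C with pst := if i + 1 = n then .allocSt x hz' else .collect x (i + 1) hz' }
          else none
      | _ => none
  | .insAlloc m' =>
      match C.pst with
      | .allocSt x hz =>
          if m' ∈ hz then none
          else some { C with
                        alloc := m'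
                        m := m'
                        pst := .resets x hz (C.used \ hz) }
      | _ => none
  | .insReset k =>
      match C.pst with
      | .resets x hz todo =>
          if k ∈ todo then
            some { C with
                     ts := Function.update C.ts k false
                     pst := .resets x hz (todo.erase k) }
          else none
      | _ => none
  | .insWrite =>
      match C.pst with
      | .resets x hz todo =>
          if todo = ∅ then
            some { C with
                     items := Function.update C.items C.m (some x)
                     used := C.used ∩ hz
                     pst := .idle }
          else none
      | _ => none
  | .takeBegin i a =>
      match C.cst i with
      | .idle =>
          if a = C.alloc then some { C with cst := Function.update C.cst i (.haz a) }
          else none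
      | _ => none
  | .takeHaz i =>
      match C.cst i with
      | .haz a =>
          some { C with
                   haz := Function.update C.haz i (some a)
                   cst := Function.update C.cst i (.read a) }
      | _ => none
  | .takeRead i xo =>
      match C.cst i with
      | .read a =>
          if xo = C.items a then
            some { C with
                     cst := Function.update C.cst i
                       (match xo with
                        | some v => .tas a v
                        | none => .clear none) }
          else none
      | _ => none
  | .takeTas i won =>
      match C.cst i with
      | .tas a x =>
          if won = !(C.ts a) then
            some { C with
                     ts := Function.update C.ts a true
                     cst := Function.update C.cst i (.clear (if won then some x else none)) }
          else none
      | _ => none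
  | .takeEnd i res =>
      match C.cst i with
      | .clear r =>
          if res = r then
            some { C with
                     haz := Function.update C.haz i none
                     cst := Function.update C.cst i .idle }
          else none
      | _ => none

/-- The initial configuration: all items ⊥, `TS[1] = 1` and all other test&set
objects 0, `Allocated = m = 1`, `used = ∅`, everyone idle. -/
def init (n : ℕ) : Cfg n where
  items := fun _ => none
  ts := fun k => decide (k = 0)
  alloc := 0
  haz := fun _ => none
  pst := .idle
  used := ∅
  m := 0
  cst := fun _ => .idle

/-- Run a list of actions from a configuration. -/
def run (n : ℕ) : List (Act n) → Cfg n → Option (Cfg n)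
  | [], C => some C
  | e :: tr, C => (step n C e).bind (run n tr)

/-- The configuration reached after the first `t` actions of `tr`. -/
def cfgAt (n : ℕ) (tr : List (Act n)) (t : ℕ) : Option (Cfg n) :=
  run n (tr.take t) (init n)

end Fig3

namespace Fig3

/-- The process performing a given action (`none` = the producer,
`some i` = consumer `i`). -/
def actor (n : ℕ) : Act n → Option (Fin n)
  | .takeBegin i _ => some i
  | .takeHaz i => some i
  | .takeRead i _ => some i
  | .takeTas i _ => some i
  | .takeEnd i _ => some i
  | _ => none

/-- In configuration `C`, performing action `e` writes to `Items[a]`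
(either the write of ⊥ on `insClear` or the write of an element on
`insWrite`, both of which write to `Items[m]`). -/
def WritesItem {n : ℕ} (C : Cfg n) (e : Act n) (a : Loc n) : Prop :=
  (e = Act.insClear ∨ e = Act.insWrite) ∧ C.m = a

end Fig3

namespace Fig3

/-- `a` is still the current location, holding `x`. -/
def Gd {n : ℕ} (C : Cfg n) (a : Loc n) (x : ℕ) : Prop :=
  (C.pst = .idle ∨ ∃ y, C.pst = .clear y) ∧ C.m = a ∧ C.items a = some x

/-- `a` is in `used`, protected by the hazard of consumer `i`. -/
def Qd {n : ℕ} (C : Cfg n) (i : Fin n) (a : Loc n) : Prop :=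
  a ∈ C.used ∧
  (∀ y j hz, C.pst = .collect y j hz → (i : ℕ) < j → a ∈ hz) ∧
  (∀ y hz, C.pst = .allocSt y hz → a ∈ hz) ∧
  (∀ y hz td, C.pst = .resets y hz td → a ∈ hz)

/-- Invariant on the producer side. -/
def PInv {n : ℕ} (C : Cfg n) : Prop :=
  (C.pst = .idle → C.m ∉ C.used ∧ (∀ k, k ≠ C.m → (C.ts k = true ↔ k ∈ C.used)) ∧
      (∀ k, k ≠ C.m → C.items k = none)) ∧
  (∀ y, C.pst = .clear y → C.m ∉ C.used ∧ (∀ k, k ≠ C.m → (C.ts k = true ↔ k ∈ C.used)) ∧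
      (∀ k, k ≠ C.m → C.items k = none) ∧ C.ts C.m = true) ∧
  (∀ y j hz, C.pst = .collect y j hz →
      (∀ k, C.ts k = true ↔ k ∈ C.used) ∧ (∀ k, C.items k = none)) ∧
  (∀ y hz, C.pst = .allocSt y hz →
      (∀ k, C.ts k = true ↔ k ∈ C.used) ∧ (∀ k, C.items k = none)) ∧
  (∀ y hz td, C.pst = .resets y hz td → C.m ∉ hz ∧ (∀ k, k ∈ td → k ∉ hz ∧ k ∈ C.used) ∧
      (∀ k, C.ts k = true ↔ k ∈ C.used ∧ (k ∈ hz ∨ k ∈ td)) ∧ (∀ k, C.items k = none))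

structure Inv {n : ℕ} (C : Cfg n) : Prop where
  p : PInv C
  rd : ∀ i a, C.cst i = .read a → C.haz i = some a
  ta : ∀ i a x, C.cst i = .tas a x → C.haz i = some a
  gq : ∀ i a x, C.cst i = .tas a x → Gd C a x ∨ Qd C i a

theorem inv_init (n : ℕ) : Inv (init n) := by
  constructor <;> simp [init, PInv]

/-- A protected location remains protected while the consumer does not move. -/
theorem qd_step {n : ℕ} {C C' : Cfg n} {e : Act n} {i : Fin n} {a : Loc n} {x : ℕ}
    (_hI : Inv C) (hs : step n C e = some C') (hh : C.haz i = some a)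
    (hc' : C'.cst i = .tas a x) (hq : Qd C i a) : Qd C' i a := by
  obtain ⟨h1, h2, h3, h4⟩ := hq
  have hi := i.2
  cases e
  case insCollect =>
    simp only [step] at hs
    split at hs <;> try contradiction
    rename_i y j hz hp
    split at hs
    · rename_i hj
      simp only [Option.some.injEq] at hs
      subst hs
      have key : (i : ℕ) < j + 1 → a ∈ (match C.haz ⟨j, hj⟩ with
          | some b => insert b hz
          | none => hz) := by
        intro hlt
        by_cases hij : (i : ℕ) < j
        · have := h2 _ _ _ hp hij
          split <;> simp [this]
        · have : (⟨j, hj⟩ : Fin n) = i := by ext; simp; omega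
          rw [this, hh]; simp
      refine ⟨h1, ?_, ?_, ?_⟩
      · intro y' j' hz' hpe hlt
        dsimp only at hpe
        split at hpe
        · cases hpe
        · injection hpe with e1 e2 e3
          subst e2 e3
          exact key hlt
      · intro y' hz' hpe
        dsimp only at hpe
        split at hpe
        · injection hpe with e1 e2
          subst e2
          exact key (by omega)
        · cases hpe
      · intro y' hz' td' hpe
        dsimp only at hpe
        split at hpe <;> cases hpe
    · cases hs
  all_goals
    simp only [step] at hs
    split at hs <;> try contradiction
  all_goals simp only [Qd] at *
  all_goals first
    | (split at hs <;> first | cases hs | skip)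
    | skip
  all_goals first
    | (simp only [Option.some.injEq] at hs; subst hs)
    | skip
  all_goals grind

theorem gq_step {n : ℕ} {C C' : Cfg n} {e : Act n} {i : Fin n} {a : Loc n} {x : ℕ}
    (hs : step n C e = some C') (hg : Gd C a x) :
    Gd C' a x ∨ (e = .insClear ∧ Qd C' i a ∧ C'.ts = C.ts ∧ C.ts a = C.ts C.m) := by
  obtain ⟨h1, h2, h3⟩ := hg
  have hi := i.2
  cases e <;> simp only [step] at hs <;> split at hs <;> try contradiction
  all_goals simp only [Qd, Gd] at *
  all_goals first
    | (split at hs <;> first | cases hs | skip)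
    | skip
  all_goals first
    | (simp only [Option.some.injEq] at hs; subst hs)
    | skip
  all_goals grind

theorem inv_step {n : ℕ} {C C' : Cfg n} {e : Act n}
    (hI : Inv C) (hs : step n C e = some C') : Inv C' := by
  have hta : ∀ i a x, C'.cst i = .tas a x → C.cst i = .tas a x ∨
      (C.cst i = .read a ∧ C.items a = some x ∧ C' = { C with cst := C'.cst }) := by
    intro i a x h
    cases e <;> simp only [step] at hs <;> split at hs <;> try contradiction
    all_goals first
      | (split at hs <;> first | cases hs | skip)
      | skip
    all_goals first
      | (simp only [Option.some.injEq] at hs; subst hs)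
      | skip
    all_goals grind
  have hgq : ∀ i a x, C'.cst i = .tas a x → Gd C' a x ∨ Qd C' i a := by
    intro i a x h
    rcases hta i a x h with h' | ⟨_, h2, h3⟩
    · rcases hI.gq i a x h' with hg | hq
      · rcases gq_step (i := i) hs hg with h | h
        · exact .inl h
        · exact .inr h.2.1
      · exact .inr (qd_step hI hs (hI.ta i a x h') h hq)
    · left
      have hp := hI.p
      rw [h3]
      simp only [Gd, PInv] at *
      cases hpst : C.pst <;> grind
  obtain ⟨hp, hr, ht, hq⟩ := hI
  refine ⟨?_, ?_, ?_, hgq⟩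
  · clear hta hgq
    simp only [PInv, Gd, Qd] at *
    obtain ⟨p1, p2, p3, p4, p5⟩ := hp
    cases e
    case insCheck x v =>
      simp only [step] at hs
      split at hs <;> try contradiction
      split at hs <;> try contradiction
      cases v <;> simp at hs <;> subst hs <;> grind
    case insCollect =>
      simp only [step] at hs
      split at hs <;> try contradiction
      rename_i y j hz hp
      have hc := p3 _ _ _ hp
      split at hs <;> try contradiction
      simp only [Option.some.injEq] at hs
      subst hs
      dsimp only
      refine ⟨?_, ?_, fun _ _ _ _ => hc, fun _ _ _ => hc, ?_⟩
      · intro h; split at h <;> cases h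
      · intro _ h; split at h <;> cases h
      · intro _ _ _ h; split at h <;> cases h
    all_goals simp only [step] at hs <;> split at hs <;> try contradiction
    all_goals first
      | (split at hs <;> first | cases hs | skip)
      | skip
    all_goals first
      | (simp only [Option.some.injEq] at hs; subst hs)
      | skip
    all_goals grind
  · intro i a h
    clear hta hgq hp hq
    cases e
    case insCheck x v =>
      simp only [step] at hs
      split at hs <;> try contradiction
      split at hs <;> try contradiction
      cases v <;> simp at hs <;> subst hs <;> grind
    all_goals simp only [step] at hs <;> split at hs <;> try contradiction
    all_goals first
      | (split at hs <;> first | cases hs | skip)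
      | skip
    all_goals first
      | (simp only [Option.some.injEq] at hs; subst hs)
      | skip
    all_goals grind
  · intro i a x h
    have := hta i a x h
    clear hta hgq hp hq
    cases e
    case insCheck x v =>
      simp only [step] at hs
      split at hs <;> try contradiction
      split at hs <;> try contradiction
      cases v <;> simp at hs <;> subst hs <;> grind
    all_goals simp only [step] at hs <;> split at hs <;> try contradiction
    all_goals first
      | (split at hs <;> first | cases hs | skip)
      | skip
    all_goals first
      | (simp only [Option.some.injEq] at hs; subst hs)
      | skip
    all_goals grind

theorem run_append (n : ℕ) (l₁ l₂ : List (Act n)) (C : Cfg n) :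
    run n (l₁ ++ l₂) C = (run n l₁ C).bind (run n l₂) := by
  induction l₁ generalizing C with
  | nil => simp [run]
  | cons e l ih =>
    simp only [List.cons_append, run]
    cases step n C e <;> simp [ih]

theorem cfgAt_succ {n : ℕ} {tr : List (Act n)} {u : ℕ} {e : Act n} (h : tr[u]? = some e) :
    cfgAt n tr (u + 1) = (cfgAt n tr u).bind (fun C => step n C e) := by
  unfold cfgAt
  rw [List.take_add_one, h, run_append]
  congr 1
  funext C
  simp only [Option.toList, run]
  cases step n C e <;> rfl

theorem cfgAt_pred {n : ℕ} {tr : List (Act n)} {u : ℕ} {C' : Cfg n} (hu : u < tr.length)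
    (h : cfgAt n tr (u + 1) = some C') :
    ∃ C e, cfgAt n tr u = some C ∧ tr[u]? = some e ∧ step n C e = some C' := by
  have he : tr[u]? = some tr[u] := List.getElem?_eq_getElem hu
  rw [cfgAt_succ he] at h
  obtain ⟨C, h1, h2⟩ := Option.bind_eq_some_iff.1 h
  exact ⟨C, _, h1, he, h2⟩

theorem inv_cfgAt {n : ℕ} {tr : List (Act n)} (u : ℕ) : ∀ {C : Cfg n}, u ≤ tr.length →
    cfgAt n tr u = some C → Inv C := by
  induction u with
  | zero => intro C _ h; simp [cfgAt, run] at h; subst h; exact inv_init n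
  | succ u ih =>
    intro C hu h
    obtain ⟨C0, e, h0, _, hs⟩ := cfgAt_pred (by omega) h
    exact inv_step (ih (by omega) h0) hs

theorem cst_step {n : ℕ} {C C' : Cfg n} {e : Act n} {i : Fin n}
    (hs : step n C e = some C') (hne : actor n e ≠ some i) : C'.cst i = C.cst i := by
  cases e <;> simp only [step] at hs <;> split at hs <;> try contradiction
  all_goals first
    | (split at hs <;> first | cases hs | skip)
    | skip
  all_goals first
    | (simp only [Option.some.injEq] at hs; subst hs)
    | skip
  all_goals simp only [actor] at hne
  all_goals grind

/-- Without writes, `Items[a]` does not change. -/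
theorem items_step {n : ℕ} {C C' : Cfg n} {e : Act n} {a : Loc n}
    (hs : step n C e = some C') (hne : ¬ WritesItem C e a) : C'.items a = C.items a := by
  cases e <;> simp only [step] at hs <;> split at hs <;> try contradiction
  all_goals first
    | (split at hs <;> first | cases hs | skip)
    | skip
  all_goals first
    | (simp only [Option.some.injEq] at hs; subst hs)
    | skip
  all_goals simp only [WritesItem] at hne
  all_goals grind

/-- While `a` is current, a set `TS[a]` stays set. -/
theorem ts_step {n : ℕ} {C C' : Cfg n} {e : Act n} {a : Loc n} {x : ℕ}
    (hs : step n C e = some C') (hg : Gd C a x) (ht : C.ts a = true) : C'.ts a = true := by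
  obtain ⟨h1, h2, h3⟩ := hg
  cases e <;> simp only [step] at hs <;> split at hs <;> try contradiction
  all_goals first
    | (split at hs <;> first | cases hs | skip)
    | skip
  all_goals first
    | (simp only [Option.some.injEq] at hs; subst hs)
    | skip
  all_goals grind

theorem qd_ts {n : ℕ} {C : Cfg n} {i : Fin n} {a : Loc n}
    (hI : Inv C) (hq : Qd C i a) : C.ts a = true := by
  have hp := hI.p
  simp only [PInv, Qd] at *
  cases hpst : C.pst <;> grind

/-- The effect of a write to `Items[a]`. -/
theorem write_step {n : ℕ} {C C' : Cfg n} {e : Act n} {a : Loc n}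
    (hs : step n C e = some C') (hw : WritesItem C e a) :
    C'.items a = none ∨ ∃ x, Gd C' a x := by
  obtain ⟨h1 | h1, h2⟩ := hw <;> subst h1 <;> simp only [step] at hs <;> split at hs <;>
    try contradiction
  · simp only [Option.some.injEq] at hs; subst hs; left; simp [h2]
  · split at hs <;> try contradiction
    simp only [Option.some.injEq] at hs; subst hs; right; simp [h2, Gd]

end Fig3

/--
In every execution of the Figure 3 algorithm, suppose a
`Take` operation `tk` (by consumer `i`) performs a successful `t&s()` of
`TS[a]` (at position `t`), and let `x` be the element `tk` last read from
`Items[a]` (at position `r`, after which `tk` takes no step until `t`).  Then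
`TS[a] = 0` and `Items[a] = x` hold continuously between the producer's last
write to `Items[a]` prior to that read (at position `s`) and the moment `tk`
performs its successful `t&s()`, i.e. in every configuration reached after
step `s` and up to (and including) the configuration in which the `t&s` is
performed.
-/
theorem fig3_between_write_and_successful_tas (n : ℕ) (tr : List (Fig3.Act n))
    (i : Fin n) (a : Fig3.Loc n) (x : ℕ) (s r t : ℕ)
    (hsr : s < r) (hrt : r ≤ t)
    (Cs Cr Ct : Fig3.Cfg n)
    (hCs : Fig3.cfgAt n tr s = some Cs)
    (hCr : Fig3.cfgAt n tr r = some Cr)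
    (hCt : Fig3.cfgAt n tr t = some Ct)
    (hvalid : (Fig3.cfgAt n tr (t + 1)).isSome)
    -- at position `s`, the producer writes to `Items[a]`, and it performs no
    -- further write to `Items[a]` before the read at position `r`
    (hws : ∃ e, tr[s]? = some e ∧ Fig3.WritesItem Cs e a)
    (hlast : ∀ u Cu e, s < u → u < r → Fig3.cfgAt n tr u = some Cu →
        tr[u]? = some e → ¬ Fig3.WritesItem Cu e a)
    -- at position `r`, consumer `i` reads `x` from `Items[a]`
    (hrd : tr[r]? = some (Fig3.Act.takeRead i (some x)))
    (hrst : Cr.cst i = Fig3.CSt.read a)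
    -- consumer `i` takes no step strictly between `r` and `t`
    (hnostep : ∀ u e, r < u → u < t → tr[u]? = some e → Fig3.actor n e ≠ some i)
    -- at position `t`, consumer `i` performs a successful `t&s()` on `TS[a]`
    (htas : tr[t]? = some (Fig3.Act.takeTas i true))
    (htst : Ct.cst i = Fig3.CSt.tas a x) :
    ∀ u Cu, s < u → u ≤ t → Fig3.cfgAt n tr u = some Cu →
      Cu.ts a = false ∧ Cu.items a = some x := by
  have hlen : t < tr.length := (List.getElem?_eq_some_iff.1 htas).1
  -- every configuration up to `t` exists
  have hex : ∀ u v C, u ≤ v → v ≤ t → Fig3.cfgAt n tr v = some C →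
      ∃ C0, Fig3.cfgAt n tr u = some C0 := by
    intro u v C huv hvt
    induction v, huv using Nat.le_induction generalizing C with
    | base => intro h; exact ⟨C, h⟩
    | succ v _ ih =>
      intro h
      obtain ⟨C0, e, h0, _⟩ := Fig3.cfgAt_pred (by omega) h
      exact ih C0 (by omega) h0
  have hinv : ∀ u C, u ≤ t → Fig3.cfgAt n tr u = some C → Fig3.Inv C :=
    fun u C hu h => Fig3.inv_cfgAt u (by omega) h
  -- facts at the read and the t&s
  have hne : r ≠ t := by
    rintro rfl; rw [hrd] at htas; cases htas
  have hxr : Cr.items a = some x := by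
    obtain ⟨C1, h1⟩ := hex (r + 1) t Ct (by omega) le_rfl hCt
    rw [Fig3.cfgAt_succ hrd, hCr] at h1
    simp only [Option.bind_some, Fig3.step, hrst] at h1
    split at h1
    · rename_i h; exact h.symm
    · cases h1
  have htf : Ct.ts a = false := by
    obtain ⟨C1, h1⟩ := Option.isSome_iff_exists.1 hvalid
    rw [Fig3.cfgAt_succ htas, hCt] at h1
    simp only [Option.bind_some, Fig3.step, htst] at h1
    split at h1
    · rename_i h; simpa using h
    · cases h1
  -- items constant between `s + 1` and `r`
  have hitems : ∀ u C, s < u → u ≤ r → Fig3.cfgAt n tr u = some C → C.items a = some x := by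
    have aux : ∀ v, s < v → v ≤ r → ∀ C C', Fig3.cfgAt n tr (s + 1) = some C →
        Fig3.cfgAt n tr v = some C' → C'.items a = C.items a := by
      intro v hv
      induction v, hv using Nat.le_induction with
      | base => intro _ C C' h h'; rw [h] at h'; cases h'; rfl
      | succ v hv ih =>
        intro hvr C C' h h'
        obtain ⟨C0, e, h0, he, hs⟩ := Fig3.cfgAt_pred (by omega) h'
        rw [Fig3.items_step hs (hlast v C0 e (by omega) (by omega) h0 he)]
        exact ih (by omega) C C0 h h0
    intro u C hu hur h
    obtain ⟨C1, h1⟩ := hex (s + 1) u C (by omega) (by omega) h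
    rw [aux u hu hur C1 C h1 h, ← aux r hsr le_rfl C1 Cr h1 hCr, hxr]
  -- `a` is current between `s + 1` and `r`
  have hG1 : ∀ u, s < u → u ≤ r → ∀ C, Fig3.cfgAt n tr u = some C → Fig3.Gd C a x := by
    intro u hu
    induction u, hu using Nat.le_induction with
    | base =>
      intro hur C h
      have hx := hitems (s + 1) C (by omega) hur h
      obtain ⟨e, he, hw⟩ := hws
      rw [Fig3.cfgAt_succ he, hCs] at h
      rcases Fig3.write_step h hw with h' | ⟨y, hy⟩
      · rw [h'] at hx; cases hx
      · have := hy.2.2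
        rw [hx] at this
        cases this
        exact hy
    | succ u hu ih =>
      intro hur C h
      obtain ⟨C0, e, h0, he, hs⟩ := Fig3.cfgAt_pred (by omega) h
      have hg := ih (by omega) C0 h0
      rcases Fig3.gq_step (i := i) hs hg with h' | ⟨h', _⟩
      · exact h'
      · exact absurd ⟨Or.inl h', hg.2.1⟩ (hlast u C0 e (by omega) (by omega) h0 he)
  -- the consumer stays at its t&s between `r + 1` and `t`
  have hcst : ∀ u, r < u → u ≤ t → ∀ C, Fig3.cfgAt n tr u = some C → C.cst i = .tas a x := by
    intro u hu
    induction u, hu using Nat.le_induction with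
    | base =>
      intro _ C h
      rw [Fig3.cfgAt_succ hrd, hCr] at h
      simp only [Option.bind_some, Fig3.step, hrst, hxr] at h
      cases h
      simp
    | succ u hu ih =>
      intro hut C h
      obtain ⟨C0, e, h0, he, hs⟩ := Fig3.cfgAt_pred (by omega) h
      rw [Fig3.cst_step hs (hnostep u e (by omega) (by omega) he)]
      exact ih (by omega) C0 h0
  -- once bad, always bad
  have hbad : ∀ u C, s < u → u ≤ t → Fig3.cfgAt n tr u = some C →
      ((Fig3.Gd C a x ∧ C.ts a = true) ∨ (r < u ∧ Fig3.Qd C i a)) → False := by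
    intro u C hu hut h hb
    have : ∀ v, u ≤ v → v ≤ t → ∀ C', Fig3.cfgAt n tr v = some C' →
        ((Fig3.Gd C' a x ∧ C'.ts a = true) ∨ (r < v ∧ Fig3.Qd C' i a)) := by
      intro v hv
      induction v, hv using Nat.le_induction with
      | base => intro _ C' h'; rw [h] at h'; cases h'; exact hb
      | succ v hv ih =>
        intro hvt C' h'
        obtain ⟨C0, e, h0, he, hs⟩ := Fig3.cfgAt_pred (by omega) h'
        rcases ih (by omega) C0 h0 with ⟨hg, ht⟩ | ⟨hrv, hq⟩
        · have ht' := Fig3.ts_step hs hg ht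
          by_cases hvr : v + 1 ≤ r
          · exact .inl ⟨hG1 (v + 1) (by omega) hvr C' h', ht'⟩
          · rcases Fig3.gq_step (i := i) hs hg with h1 | h1
            · exact .inl ⟨h1, ht'⟩
            · exact .inr ⟨by omega, h1.2.1⟩
        · refine .inr ⟨by omega, Fig3.qd_step (x := x) (hinv v C0 (by omega) h0) hs
            ((hinv v C0 (by omega) h0).ta i a x (hcst v hrv (by omega) C0 h0))
            (hcst (v + 1) (by omega) hvt C' h') hq⟩
    have htt : Ct.ts a = true := by
      rcases this t hut le_rfl Ct hCt with ⟨_, h⟩ | ⟨_, h⟩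
      · exact h
      · exact Fig3.qd_ts (hinv t Ct le_rfl hCt) h
    rw [htf] at htt
    cases htt
  intro u Cu hu hut h
  have hg : Fig3.Gd Cu a x := by
    by_cases hur : u ≤ r
    · exact hG1 u hu hur Cu h
    · rcases (hinv u Cu hut h).gq i a x (hcst u (by omega) hut Cu h) with hg | hq
      · exact hg
      · exact (hbad u Cu hu hut h (.inr ⟨by omega, hq⟩)).elim
  refine ⟨?_, hg.2.2⟩
  by_contra hc
  exact hbad u Cu hu hut h (.inl ⟨hg, by simpa using hc⟩)
end

section
/- In every execution of the Figure 5 algorithm, if an Insert(x₁) operation writes x₁ to Items[a], then the Take operation that performs the first successful t&s() on TS[a] after that write returns x₁. -/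
/-!
A formal model of the algorithm of Figure 5 (a lock-free,
strongly-linearizable `b`-bounded bag with one producer and `n` consumers).

Locations `1 .. n+b` are modelled as `Fin (n+b)`.  Registers holding elements
or ⊥ are modelled as `Option ℕ` (`none` = ⊥) and test&set objects as `Bool`
(`true` = 1).  The ABA-detecting registers `InsertDone` and `TakeDone` are
modelled by write counters (`icount`, `tcount`) together with the counter
value recorded at the last `dRead()` of each reader (`ilast i` for consumer
`i` reading `InsertDone`; `tlast` for the producer reading `TakeDone`); a
`dRead()` returns `true` iff the reader has read before and the counter has
increased since.

An execution is a list of actions (`Act`), each performing (at most) one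
shared-memory access; results of accesses and nondeterministic choices are
recorded in the action.  `step` is the (partial) transition function.  The
purely local control transitions at the end of the producer's scan of `alloc`
(`insScanDone`) are modelled as separate actions.
-/

namespace Fig5

/-- Local state of the producer, besides the persistent local variables
`used` and `alloc` kept in the configuration. -/
inductive PSt (n b : ℕ) where
  | idle : PSt n b
  /-- scanning the locations of `alloc` that are still `pending` -/
  | scan (x : ℕ) (pending : Finset (Fin (n + b))) : PSt n b
  /-- collecting `Hazards`; `i` is the next index to read -/
  | collect (x : ℕ) (i : ℕ) (hz : Finset (Fin (n + b))) : PSt n b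
  /-- about to choose a fresh location and write `Allocated` -/
  | allocSt (x : ℕ) (hz : Finset (Fin (n + b))) : PSt n b
  /-- chose location `m`; resetting the test&set objects in `todo` -/
  | resets (x : ℕ) (hz : Finset (Fin (n + b))) (m : Fin (n + b))
      (todo : Finset (Fin (n + b))) : PSt n b
  /-- wrote the element, about to perform `InsertDone.dWrite()` -/
  | dw : PSt n b
  /-- `|alloc| = b`; about to re-read `TakeDone` -/
  | recheck (x : ℕ) : PSt n b
  deriving DecidableEq

/-- Local state of a consumer. -/
inductive CSt (n b : ℕ) where
  | idle : CSt n b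
  /-- about to read `Allocated` -/
  | loopStart : CSt n b
  /-- iterating over the locations read from `Allocated` that are still
      `pending` -/
  | scan (pending : Finset (Fin (n + b))) : CSt n b
  /-- about to write `a` to `Hazards[i]` -/
  | haz (pending : Finset (Fin (n + b))) (a : Fin (n + b)) : CSt n b
  /-- about to read `Items[a]` -/
  | read (pending : Finset (Fin (n + b))) (a : Fin (n + b)) : CSt n b
  /-- read `x ≠ ⊥` from `Items[a]`, about to perform `t&s()` on `TS[a]` -/
  | tas (pending : Finset (Fin (n + b))) (a : Fin (n + b)) (x : ℕ) : CSt n b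
  /-- successful `t&s`; about to write ⊥ to `Hazards[i]` -/
  | retClear (x : ℕ) : CSt n b
  /-- about to perform `TakeDone.dWrite()` and return `x` -/
  | retDone (x : ℕ) : CSt n b
  /-- about to re-read `InsertDone` -/
  | recheck : CSt n b
  /-- about to perform `TakeDone.dWrite()` and return EMPTY -/
  | emptyDone : CSt n b
  deriving DecidableEq

structure Cfg (n b : ℕ) where
  items : Fin (n + b) → Option ℕ
  ts : Fin (n + b) → Bool
  /-- the shared register `Allocated` -/
  allocated : Finset (Fin (n + b))
  haz : Fin n → Option (Fin (n + b))
  /-- number of `dWrite()`s to `InsertDone` -/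
  icount : ℕ
  /-- value of `icount` at consumer `i`'s last `dRead()` of `InsertDone` -/
  ilast : Fin n → Option ℕ
  /-- number of `dWrite()`s to `TakeDone` -/
  tcount : ℕ
  /-- value of `tcount` at the producer's last `dRead()` of `TakeDone` -/
  tlast : Option ℕ
  pst : PSt n b
  /-- the producer's persistent local variable `used` -/
  used : Finset (Fin (n + b))
  /-- the producer's persistent local variable `alloc` -/
  palloc : Finset (Fin (n + b))
  cst : Fin n → CSt n b

inductive Act (n b : ℕ) where
  /-- the producer begins `Insert(x)` by performing `TakeDone.dRead()` -/
  | insBegin (x : ℕ) : Act n b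
  /-- the producer reads `TS[m]` for the pending location `m` of its scan,
      obtaining `v`; if `v = true` it also writes ⊥ to `Items[m]`, removes `m`
      from `alloc` and adds it to `used` -/
  | insScan (m : Fin (n + b)) (v : Bool) : Act n b
  /-- local step: the scan is finished; proceed according to `|alloc| < b` -/
  | insScanDone : Act n b
  /-- the producer reads the next entry of `Hazards` -/
  | insCollect : Act n b
  /-- the producer chooses a fresh location `m'` (not in `alloc` and not
      hazardous), adds it to `alloc` and writes `alloc` to `Allocated` -/
  | insAlloc (m' : Fin (n + b)) : Act n b
  /-- the producer resets `TS[k]` -/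
  | insReset (k : Fin (n + b)) : Act n b
  /-- the producer writes its element to `Items[m]` -/
  | insWrite : Act n b
  /-- the producer performs `InsertDone.dWrite()` and returns OK -/
  | insDone : Act n b
  /-- the producer re-reads `TakeDone`, obtaining `v`; if `v = false` the
      `Insert` completes returning FULL -/
  | insRecheck (v : Bool) : Act n b
  /-- consumer `i` begins `Take()` by performing `InsertDone.dRead()` -/
  | takeBegin (i : Fin n) : Act n b
  /-- consumer `i` reads `Allocated` -/
  | takeAlloc (i : Fin n) : Act n b
  /-- consumer `i` picks the pending location `a` and writes it to
      `Hazards[i]` -/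
  | takeHaz (i : Fin n) (a : Fin (n + b)) : Act n b
  /-- consumer `i` reads `Items[a]`, obtaining `xo` -/
  | takeRead (i : Fin n) (xo : Option ℕ) : Act n b
  /-- consumer `i` performs `t&s()` on `TS[a]`; `won = true` iff successful -/
  | takeTas (i : Fin n) (won : Bool) : Act n b
  /-- consumer `i` finished its scan; it writes ⊥ to `Hazards[i]` -/
  | takeScanEnd (i : Fin n) : Act n b
  /-- consumer `i` writes ⊥ to `Hazards[i]` after a successful `t&s` -/
  | takeRetClear (i : Fin n) : Act n b
  /-- consumer `i` performs `TakeDone.dWrite()` and returns `x` -/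
  | takeRetDone (i : Fin n) (x : ℕ) : Act n b
  /-- consumer `i` re-reads `InsertDone`, obtaining `v` -/
  | takeRecheck (i : Fin n) (v : Bool) : Act n b
  /-- consumer `i` performs `TakeDone.dWrite()` and returns EMPTY -/
  | takeEmptyDone (i : Fin n) : Act n b
  deriving DecidableEq

/-- Result of an `InsertDone.dRead()` by consumer `i`. -/
def ireadVal {n b : ℕ} (C : Cfg n b) (i : Fin n) : Bool :=
  match C.ilast i with
  | none => false
  | some c => decide (c < C.icount)

/-- Result of a `TakeDone.dRead()` by the producer. -/
def treadVal {n b : ℕ} (C : Cfg n b) : Bool :=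
  match C.tlast with
  | none => false
  | some c => decide (c < C.tcount)

def step (n b : ℕ) (C : Cfg n b) : Act n b → Option (Cfg n b)
  | .insBegin x =>
      match C.pst with
      | .idle =>
          some { C with
                   tlast := some C.tcount
                   pst := .scan x C.palloc }
      | _ => none
  | .insScan m v =>
      match C.pst with
      | .scan x pending =>
          if m ∈ pending ∧ v = C.ts m then
            if v then
              some { C with
                       items := Function.update C.items m none
                       palloc := C.palloc.erase m
                       used := insert m C.used
                       pst := .scan x (pending.erase m) }
            else
              some { C with pst := .scan x (pending.erase m) }
          else none
      | _ => none
  | .insScanDone =>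
      match C.pst with
      | .scan x pending =>
          if pending = ∅ then
            if C.palloc.card < b then
              some { C with pst := if n = 0 then .allocSt x ∅ else .collect x 0 ∅ }
            else
              some { C with pst := .recheck x }
          else none
      | _ => none
  | .insCollect =>
      match C.pst with
      | .collect x i hz =>
          if h : i < n then
            let hz' := match C.haz ⟨i, h⟩ with
                       | some a => insert a hz
                       | none => hz
            some { C with pst := if i + 1 = n then .allocSt x hz' else .collect x (i + 1) hz' }
          else none
      | _ => none
  | .insAlloc m' =>
      match C.pst with
      | .allocSt x hz =>
          if m' ∈ C.palloc ∨ m' ∈ hz then none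
          else
            some { C with
                     palloc := insert m' C.palloc
                     allocated := insert m' C.palloc
                     pst := .resets x hz m' (C.used \ hz) }
      | _ => none
  | .insReset k =>
      match C.pst with
      | .resets x hz m todo =>
          if k ∈ todo then
            some { C with
                     ts := Function.update C.ts k false
                     pst := .resets x hz m (todo.erase k) }
          else none
      | _ => none
  | .insWrite =>
      match C.pst with
      | .resets x hz m todo =>
          if todo = ∅ then
            some { C with
                     items := Function.update C.items m (some x)
                     used := C.used ∩ hz
                     pst := .dw }
          else none
      | _ => none
  | .insDone =>
      match C.pst with
      | .dw => some { C with icount := C.icount + 1, pst := .idle }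
      | _ => none
  | .insRecheck v =>
      match C.pst with
      | .recheck x =>
          if v = treadVal C then
            some { C with
                     tlast := some C.tcount
                     pst := if v then .scan x C.palloc else .idle }
          else none
      | _ => none
  | .takeBegin i =>
      match C.cst i with
      | .idle =>
          some { C with
                   ilast := Function.update C.ilast i (some C.icount)
                   cst := Function.update C.cst i .loopStart }
      | _ => none
  | .takeAlloc i =>
      match C.cst i with
      | .loopStart =>
          some { C with cst := Function.update C.cst i (.scan C.allocated) }
      | _ => none
  | .takeHaz i a =>
      match C.cst i with
      | .scan pending =>
          if a ∈ pending then
            some { C with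
                     haz := Function.update C.haz i (some a)
                     cst := Function.update C.cst i (.read (pending.erase a) a) }
          else none
      | _ => none
  | .takeRead i xo =>
      match C.cst i with
      | .read pending a =>
          if xo = C.items a then
            some { C with
                     cst := Function.update C.cst i
                       (match xo with
                        | some v => .tas pending a v
                        | none => .scan pending) }
          else none
      | _ => none
  | .takeTas i won =>
      match C.cst i with
      | .tas pending a x =>
          if won = !(C.ts a) then
            some { C with
                     ts := Function.update C.ts a true
                     cst := Function.update C.cst i
                       (if won then .retClear x else .scan pending) }
          else none
      | _ => none
  | .takeScanEnd i =>
      match C.cst i with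
      | .scan pending =>
          if pending = ∅ then
            some { C with
                     haz := Function.update C.haz i none
                     cst := Function.update C.cst i .recheck }
          else none
      | _ => none
  | .takeRetClear i =>
      match C.cst i with
      | .retClear x =>
          some { C with
                   haz := Function.update C.haz i none
                   cst := Function.update C.cst i (.retDone x) }
      | _ => none
  | .takeRetDone i x =>
      match C.cst i with
      | .retDone x' =>
          if x = x' then
            some { C with
                     tcount := C.tcount + 1
                     cst := Function.update C.cst i .idle }
          else none
      | _ => none
  | .takeRecheck i v =>
      match C.cst i with
      | .recheck =>
          if v = ireadVal C i then
            some { C with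
                     ilast := Function.update C.ilast i (some C.icount)
                     cst := Function.update C.cst i (if v then .loopStart else .emptyDone) }
          else none
      | _ => none
  | .takeEmptyDone i =>
      match C.cst i with
      | .emptyDone =>
          some { C with
                   tcount := C.tcount + 1
                   cst := Function.update C.cst i .idle }
      | _ => none

def init (n b : ℕ) : Cfg n b where
  items := fun _ => none
  ts := fun _ => false
  allocated := ∅
  haz := fun _ => none
  icount := 0
  ilast := fun _ => none
  tcount := 0
  tlast := none
  pst := .idle
  used := ∅
  palloc := ∅
  cst := fun _ => .idle

def run (n b : ℕ) : List (Act n b) → Cfg n b → Option (Cfg n b)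
  | [], C => some C
  | e :: tr, C => (step n b C e).bind (run n b tr)

/-- The configuration reached after the first `t` actions of `tr`. -/
def cfgAt (n b : ℕ) (tr : List (Act n b)) (t : ℕ) : Option (Cfg n b) :=
  run n b (tr.take t) (init n b)

end Fig5

namespace Fig5

/-- The inductive invariant of the algorithm. -/
structure Inv {n b : ℕ} (C : Cfg n b) : Prop where
  hzRead : ∀ i p c, C.cst i = .read p c → C.haz i = some c
  hzTas : ∀ i p c x, C.cst i = .tas p c x → C.haz i = some c
  itemsNone : ∀ c, c ∉ C.palloc → C.items c = none
  itemsFresh : ∀ x hz m todo, C.pst = .resets x hz m todo → C.items m = none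
  live : ∀ i p c x, C.cst i = .tas p c x →
    (c ∈ C.palloc ∧ C.items c = some x) ∨ c ∈ C.used
  tsFree : ∀ c, c ∉ C.palloc → c ∉ C.used → C.ts c = false
  disj : ∀ c, c ∈ C.palloc → c ∈ C.used → ∃ x hz todo, C.pst = .resets x hz c todo
  scan : ∀ x pend, C.pst = .scan x pend → pend ⊆ C.palloc
  coll : ∀ x k hz, C.pst = .collect x k hz → ∀ j p c y, C.cst j = .tas p c y →
    c ∈ C.used → j.val < k → c ∈ hz
  allc : ∀ x hz, C.pst = .allocSt x hz → ∀ j p c y, C.cst j = .tas p c y →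
    c ∈ C.used → c ∈ hz
  rstTas : ∀ x hz m todo, C.pst = .resets x hz m todo → ∀ j p c y,
    C.cst j = .tas p c y → c ∈ C.used → c ∈ hz
  rstM : ∀ x hz m todo, C.pst = .resets x hz m todo → m ∈ C.palloc ∧ m ∉ hz
  rstTodo : ∀ x hz m todo, C.pst = .resets x hz m todo → ∀ c ∈ todo, c ∈ C.used ∧ c ∉ hz
  rstTs : ∀ x hz m todo, C.pst = .resets x hz m todo → ∀ c ∈ C.used, c ∉ hz → c ∉ todo →
    C.ts c = false
  rstTsM : ∀ x hz m todo, C.pst = .resets x hz m todo → m ∉ todo → C.ts m = false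

theorem inv_init (n b : ℕ) : Inv (init n b) := by
  constructor <;> simp [init]

set_option maxHeartbeats 4000000 in
theorem inv_step {n b : ℕ} {C C' : Cfg n b} {e : Act n b} (h : Inv C)
    (hs : step n b C e = some C') : Inv C' := by
  obtain ⟨h1, h2, h3, h4, h5, h6, h7, h8, h9, h10, h11, h12, h13, h14, h15⟩ := h
  cases e <;> simp only [step] at hs <;> split at hs <;> (try contradiction) <;>
    (try split at hs) <;> (try contradiction) <;> (try split at hs) <;>
    simp only [Option.some.injEq] at hs <;> subst hs <;>
    constructor <;> dsimp only <;> first | assumption | skip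
  all_goals try grind
  · intro x hz hx j
    have := j.pos
    grind
  · intro c hc hu
    rcases Finset.mem_insert.1 hc with rfl | hc
    · exact ⟨_, _, _, rfl⟩
    · grind

/-- What holds between the write of `x₁` to `Items[a]` and the next successful `t&s()`. -/
structure Post {n b : ℕ} (a : Fin (n + b)) (x₁ : ℕ) (C : Cfg n b) : Prop where
  inv : Inv C
  mem : a ∈ C.palloc
  item : C.items a = some x₁
  ts : C.ts a = false

theorem post_write {n b : ℕ} {C C' : Cfg n b} {x₁ : ℕ} {hz} {a : Fin (n + b)} (h : Inv C)
    (hp : C.pst = .resets x₁ hz a ∅) (hs : step n b C .insWrite = some C') :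
    Post a x₁ C' := by
  have hi := inv_step h hs
  have h1 := (h.rstM _ _ _ _ hp).1
  have h2 := h.rstTsM _ _ _ _ hp
  simp only [step, hp, if_true, Option.some.injEq] at hs
  subst hs
  exact ⟨hi, h1, by simp, by simpa using h2⟩

theorem post_step {n b : ℕ} {C C' : Cfg n b} {e : Act n b} {x₁ : ℕ} {a : Fin (n + b)}
    (h : Post a x₁ C) (hs : step n b C e = some C')
    (hn : ∀ j p y, e = .takeTas j true → C.cst j ≠ .tas p a y) : Post a x₁ C' := by
  have hi := inv_step h.inv hs
  obtain ⟨hI, hm, hit, hts⟩ := h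
  have h4 := hI.itemsFresh
  have h7 := hI.disj
  have h13 := hI.rstTodo
  clear hI
  suffices a ∈ C'.palloc ∧ C'.items a = some x₁ ∧ C'.ts a = false from
    ⟨hi, this.1, this.2.1, this.2.2⟩
  clear hi
  cases e <;> simp only [step] at hs <;> split at hs <;> (try contradiction) <;>
    (try split at hs) <;> (try contradiction) <;> (try split at hs) <;>
    simp only [Option.some.injEq] at hs <;> subst hs <;> dsimp only <;> grind

theorem run_append {n b : ℕ} (l₁ l₂ : List (Act n b)) (C : Cfg n b) :
    run n b (l₁ ++ l₂) C = (run n b l₁ C).bind (run n b l₂) := by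
  induction l₁ generalizing C with
  | nil => simp [run]
  | cons e l ih =>
    simp only [List.cons_append, run]
    cases step n b C e <;> simp [ih]

theorem cfgAt_succ {n b : ℕ} {tr : List (Act n b)} {t : ℕ} {e : Act n b}
    (he : tr[t]? = some e) :
    cfgAt n b tr (t + 1) = (cfgAt n b tr t).bind (fun C => step n b C e) := by
  unfold cfgAt
  rw [List.take_add_one, he, run_append]
  congr 1
  funext C
  simp only [Option.toList, run]
  cases step n b C e <;> simp [run]

/-- Decomposition of a nonempty prefix of an execution. -/
theorem cfgAt_pred {n b : ℕ} {tr : List (Act n b)} {t : ℕ} {C' : Cfg n b}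
    (h : cfgAt n b tr (t + 1) = some C') :
    (∃ e C, tr[t]? = some e ∧ cfgAt n b tr t = some C ∧ step n b C e = some C') ∨
      (tr[t]? = none ∧ cfgAt n b tr t = some C') := by
  rcases he : tr[t]? with _ | e
  · right
    refine ⟨rfl, ?_⟩
    unfold cfgAt at h ⊢
    rw [List.take_add_one, he] at h
    simpa using h
  · left
    rw [cfgAt_succ he] at h
    obtain ⟨C, hC, hs⟩ := Option.bind_eq_some_iff.1 h
    exact ⟨e, C, rfl, hC, hs⟩

theorem inv_cfgAt {n b : ℕ} {tr : List (Act n b)} (t : ℕ) {C : Cfg n b}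
    (h : cfgAt n b tr t = some C) : Inv C := by
  induction t generalizing C with
  | zero =>
    simp only [cfgAt, List.take_zero, run, Option.some.injEq] at h
    exact h ▸ inv_init n b
  | succ t ih =>
    rcases cfgAt_pred h with ⟨e, D, _, hD, hs⟩ | ⟨_, hD⟩
    · exact inv_step (ih hD) hs
    · exact ih hD

end Fig5

/--
In every execution of the Figure 5 algorithm, if an
`Insert(x₁)` operation writes `x₁` to `Items[a]` (at position `w`), then the
`Take` operation that performs the first successful `t&s()` on `TS[a]` after
that write (at position `t`) returns `x₁` (i.e. the element it last read from
`Items[a]`, which it will return, is `x₁`).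
-/
theorem fig5_first_tas_after_write_returns_item (n b : ℕ) (tr : List (Fig5.Act n b))
    (w t : ℕ) (x₁ : ℕ) (hz : Finset (Fin (n + b))) (a : Fin (n + b))
    (Cw Ct : Fig5.Cfg n b)
    -- at position `w`, the producer writes `x₁` to `Items[a]`
    (hCw : Fig5.cfgAt n b tr w = some Cw)
    (hw : tr[w]? = some Fig5.Act.insWrite)
    (hpst : Cw.pst = Fig5.PSt.resets x₁ hz a ∅)
    (hwt : w < t)
    -- at position `t`, consumer `i` performs a successful `t&s()` on `TS[a]`,
    -- having last read `y` from `Items[a]`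
    (i : Fin n) (p : Finset (Fin (n + b))) (y : ℕ)
    (hCt : Fig5.cfgAt n b tr t = some Ct)
    (htas : tr[t]? = some (Fig5.Act.takeTas i true))
    (hst : Ct.cst i = Fig5.CSt.tas p a y)
    (hvalid : (Fig5.cfgAt n b tr (t + 1)).isSome)
    -- and this is the first successful `t&s()` on `TS[a]` after `w`
    (hfirst : ∀ u j Cu pu yu, w < u → u < t →
        Fig5.cfgAt n b tr u = some Cu →
        tr[u]? = some (Fig5.Act.takeTas j true) →
        Cu.cst j ≠ Fig5.CSt.tas pu a yu) :
    y = x₁ := by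
  have key : ∀ u, w + 1 ≤ u → u ≤ t → ∀ C, Fig5.cfgAt n b tr u = some C →
      Fig5.Post a x₁ C := by
    intro u hu
    induction u, hu using Nat.le_induction with
    | base =>
      intro _ C hC
      rw [Fig5.cfgAt_succ hw, hCw] at hC
      exact Fig5.post_write (Fig5.inv_cfgAt w hCw) hpst hC
    | succ u hu ih =>
      intro hut C hC
      rcases Fig5.cfgAt_pred hC with ⟨e, D, he, hD, hs⟩ | ⟨_, hD⟩
      · refine Fig5.post_step (ih (by omega) D hD) hs ?_
        intro j q z hej
        exact hfirst u j D q z (by omega) (by omega) hD (hej ▸ he)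
      · exact ih (by omega) C hD
  have hP := key t hwt le_rfl Ct hCt
  rcases hP.inv.live _ _ _ _ hst with ⟨_, h⟩ | h
  · have := hP.item
    rw [h] at this
    exact Option.some.inj this
  · obtain ⟨x, hz', todo, h⟩ := hP.inv.disj _ hP.mem h
    have h1 := hP.inv.itemsFresh _ _ _ _ h
    rw [hP.item] at h1
    cases h1
end
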